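/- Let R be a principal ideal domain with field of fractions F, let 0 < r < n, f = n − r, let d ∈ R be nonzero, K ∈ M_{r,f}(R), and J = (d·I_r | K), with N the nullspace of J in R^n and W the R-span of V(1), …, V(f). Let q_1 | ⋯ | q_s be the diagonal entries of the Smith normal form of K and let t be the rank of K. Then N/dW ≅ R/R·gcd(d, q_1) ⊕ ⋯ ⊕ R/R·gcd(d, q_t) ⊕ (R/Rd)^{f−t}. -/

import Mathlib

open scoped Pointwise

/-- The matrix `J = (d·I_r | K) ∈ M_{r,n}(R)`: its first `r` columns form `d·I_r`
and its last `n - r` columns form `K`. -/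
noncomputable def Jmat (R : Type*) [CommRing R] (r n : ℕ) (d : R)
    (K : Matrix (Fin r) (Fin (n - r)) R) : Matrix (Fin r) (Fin n) R := fun i j =>
  if hj : (j : ℕ) < r then (if (i : ℕ) = (j : ℕ) then d else 0)
  else K i ⟨(j : ℕ) - r, by have := j.isLt; omega⟩

/-- The vector `V(j) ∈ F^n` whose `i`-th coordinate is `-K_{i,j}/d` for `i < r`,
which is `1` in position `r + j`, and `0` elsewhere. -/
noncomputable def Vvec (R : Type*) [CommRing R] [IsDomain R] (r n : ℕ) (d : R)
    (K : Matrix (Fin r) (Fin (n - r)) R) (j : Fin (n - r)) :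
    Fin n → FractionRing R := fun i =>
  if hi : (i : ℕ) < r then
    -(algebraMap R (FractionRing R) (K ⟨(i : ℕ), hi⟩ j)) / algebraMap R (FractionRing R) d
  else if (i : ℕ) = r + (j : ℕ) then 1 else 0

/-- The coordinatewise inclusion `R^n → F^n`, as an `R`-linear map. -/
noncomputable def toFrac (R : Type*) [CommRing R] (n : ℕ) :
    (Fin n → R) →ₗ[R] (Fin n → FractionRing R) :=
  LinearMap.pi fun i => (Algebra.linearMap R (FractionRing R)).comp (LinearMap.proj i)

/-- The nullspace `N = {X ∈ R^n : JX = 0}` of `J` in `R^n`, viewed (via the inclusion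
`R^n ⊆ F^n`) as an `R`-submodule of `F^n`. -/
noncomputable def Nsub (R : Type*) [CommRing R] [IsDomain R] (r n : ℕ) (d : R)
    (K : Matrix (Fin r) (Fin (n - r)) R) : Submodule R (Fin n → FractionRing R) :=
  (LinearMap.ker (Jmat R r n d K).mulVecLin).map (toFrac R n)

/-- `W`, the `R`-span of `V(1), …, V(f)` in `F^n`. -/
noncomputable def Wsub (R : Type*) [CommRing R] [IsDomain R] (r n : ℕ) (d : R)
    (K : Matrix (Fin r) (Fin (n - r)) R) : Submodule R (Fin n → FractionRing R) :=
  Submodule.span R (Set.range (Vvec R r n d K))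

/-- If `Ψ` identifies `A` with `N` and `T : A → B` is onto with kernel `Ψ⁻¹(D)`, then
`N / (N ∩ D) ≅ B`. -/
theorem nonempty_quotient_comap_subtype_equiv {R A B M : Type*} [CommRing R]
    [AddCommGroup A] [Module R A] [AddCommGroup B] [Module R B] [AddCommGroup M] [Module R M]
    (N D : Submodule R M) (Ψ : A →ₗ[R] M) (hΨ : Function.Injective Ψ)
    (hN : LinearMap.range Ψ = N) (T : A →ₗ[R] B) (hT : Function.Surjective T)
    (hTD : ∀ a, T a = 0 ↔ Ψ a ∈ D) :
    Nonempty ((N ⧸ D.comap N.subtype) ≃ₗ[R] B) := by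
  subst hN
  let e := LinearEquiv.ofInjective Ψ hΨ
  let S : LinearMap.range Ψ →ₗ[R] B := T.comp e.symm.toLinearMap
  have hS : Function.Surjective S := hT.comp e.symm.surjective
  refine ⟨(Submodule.quotEquivOfEq _ _ ?_).trans (S.quotKerEquivOfSurjective hS)⟩
  ext x
  obtain ⟨a, rfl⟩ := e.surjective x
  simp [S, hTD, e]

/-- If `g` is a gcd of `d = g * c` and `q`, then `d ∣ q * z` exactly when `c ∣ z`. -/
theorem dvd_mul_iff_of_isGCD {R : Type*} [CommRing R] [IsDomain R] [IsPrincipalIdealRing R]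
    {d q g c : R} (hd : d ≠ 0) (hc : d = g * c) (hgq : g ∣ q)
    (hg : ∀ b, b ∣ d → b ∣ q → b ∣ g) (z : R) : d ∣ q * z ↔ c ∣ z := by
  constructor
  · rintro ⟨w, hw⟩
    obtain ⟨h, hh⟩ := (IsPrincipalIdealRing.principal (Ideal.span {d, q})).principal
    have hdvd : ∀ x ∈ Ideal.span {d, q}, h ∣ x := fun x hx => by
      rw [hh] at hx
      exact Ideal.mem_span_singleton.1 hx
    have hhg : h ∣ g := hg h (hdvd d (Ideal.subset_span (by simp)))
      (hdvd q (Ideal.subset_span (by simp)))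
    have hmem : g ∈ Ideal.span {d, q} := by
      rw [hh]
      exact Ideal.mem_span_singleton.2 hhg
    obtain ⟨a, b, hab⟩ := Ideal.mem_span_pair.1 hmem
    have hg0 : g ≠ 0 := by
      rintro rfl
      simp [hc] at hd
    refine (mul_dvd_mul_iff_left hg0).1 ⟨a * z + b * w, ?_⟩
    rw [← hc]
    linear_combination (-z) * hab + b * hw
  · rintro ⟨w, rfl⟩
    obtain ⟨k, rfl⟩ := hgq
    exact ⟨k * w, by rw [hc]; ring⟩

/-- Divisibility of all coordinates is preserved by a matrix. -/
theorem dvd_mulVec {R m n : Type*} [CommRing R] [Fintype n] {d : R}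
    (A : Matrix m n R) {v : n → R} (hv : ∀ i, d ∣ v i) (i : m) : d ∣ A.mulVec v i :=
  Finset.dvd_sum fun j _ => (hv j).mul_left _

theorem dvd_units_mulVec_iff {R m : Type*} [CommRing R] [Fintype m] [DecidableEq m] {d : R}
    (P : (Matrix m m R)ˣ) (v : m → R) :
    (∀ i, d ∣ P.val.mulVec v i) ↔ ∀ i, d ∣ v i := by
  refine ⟨fun h i => ?_, fun h => dvd_mulVec _ h⟩
  have := dvd_mulVec P⁻¹.val h i
  rwa [Matrix.mulVec_mulVec, P.inv_mul, Matrix.one_mulVec] at this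

/-- The splitting of the coordinates of `R^n` into the first `r` and the last `n - r`. -/
def finSplit {r n : ℕ} (hrn : r ≤ n) : Fin r ⊕ Fin (n - r) ≃ Fin n :=
  finSumFinEquiv.trans (finCongr (by omega))

@[simp]
theorem finSplit_inl_val {r n : ℕ} (hrn : r ≤ n) (i : Fin r) :
    (finSplit hrn (Sum.inl i) : ℕ) = i := by
  simp [finSplit]

@[simp]
theorem finSplit_inr_val {r n : ℕ} (hrn : r ≤ n) (j : Fin (n - r)) :
    (finSplit hrn (Sum.inr j) : ℕ) = r + j := by
  simp [finSplit]

theorem Jmat_mulVec {R : Type*} [CommRing R] {r n : ℕ} (hrn : r ≤ n) (d : R)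
    (K : Matrix (Fin r) (Fin (n - r)) R) (x : Fin n → R) (i : Fin r) :
    (Jmat R r n d K).mulVec x i = d * x (finSplit hrn (Sum.inl i)) +
      K.mulVec (fun j => x (finSplit hrn (Sum.inr j))) i := by
  rw [Matrix.mulVec, dotProduct, ← (finSplit hrn).sum_comp, Fintype.sum_sum_type]
  congr 1
  · simp [Jmat, Fin.val_inj]
  · simp [Jmat, Matrix.mulVec, dotProduct]

section

variable {R : Type*} [CommRing R] [IsDomain R] {r n : ℕ} (d : R)
  (K : Matrix (Fin r) (Fin (n - r)) R)

/-- The map `R^f → F^n` sending the `j`-th basis vector to `V(j)`. -/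
noncomputable def Vcomb : (Fin (n - r) → R) →ₗ[R] (Fin n → FractionRing R) :=
  Fintype.linearCombination R (Vvec R r n d K)

theorem Vcomb_inl (hrn : r ≤ n) (y : Fin (n - r) → R) (i : Fin r) :
    Vcomb d K y (finSplit hrn (Sum.inl i)) =
      -algebraMap R (FractionRing R) (K.mulVec y i) / algebraMap R (FractionRing R) d := by
  rw [Vcomb, Fintype.linearCombination_apply, Finset.sum_apply, Matrix.mulVec, dotProduct, map_sum,
    ← Finset.sum_neg_distrib, Finset.sum_div]
  refine Finset.sum_congr rfl fun j _ => ?_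
  rw [Pi.smul_apply, Algebra.smul_def]
  simp only [Vvec, finSplit_inl_val, i.isLt, dite_true, Fin.eta, map_mul]
  ring

theorem Vcomb_inr (hrn : r ≤ n) (y : Fin (n - r) → R) (j : Fin (n - r)) :
    Vcomb d K y (finSplit hrn (Sum.inr j)) = algebraMap R (FractionRing R) (y j) := by
  simp [Vcomb, Fintype.linearCombination_apply, Vvec, Fin.val_inj, Algebra.smul_def]

theorem Vcomb_injective (hrn : r ≤ n) : Function.Injective (Vcomb d K) := fun y z h => by
  ext j
  have := congrFun h (finSplit hrn (Sum.inr j))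
  rw [Vcomb_inr, Vcomb_inr] at this
  exact IsFractionRing.injective R (FractionRing R) this

theorem range_Vcomb : LinearMap.range (Vcomb d K) = Wsub R r n d K :=
  Fintype.range_linearCombination R _

theorem Vcomb_mem_smul_Wsub_iff (hrn : r ≤ n) (y : Fin (n - r) → R) :
    Vcomb d K y ∈ d • Wsub R r n d K ↔ ∀ j, d ∣ y j := by
  rw [← range_Vcomb, Submodule.mem_smul_pointwise_iff_exists]
  constructor
  · rintro ⟨_, ⟨w, rfl⟩, hw⟩ j
    rw [← map_smul] at hw
    exact ⟨w j, (congrFun (Vcomb_injective d K hrn hw) j).symm⟩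
  · intro h
    choose w hw using h
    exact ⟨_, ⟨w, rfl⟩, by rw [← map_smul]; exact congrArg _ (funext fun j => (hw j).symm)⟩

variable {d}

theorem mem_Nsub_iff (hrn : r ≤ n) (hd : d ≠ 0) (v : Fin n → FractionRing R) :
    v ∈ Nsub R r n d K ↔ ∃ y, Vcomb d K y = v ∧ ∀ i, d ∣ K.mulVec y i := by
  have hd' : algebraMap R (FractionRing R) d ≠ 0 := by simpa using hd
  constructor
  · rintro ⟨x, hx, rfl⟩
    have hJ (i : Fin r) : d * x (finSplit hrn (Sum.inl i)) +
        K.mulVec (fun j => x (finSplit hrn (Sum.inr j))) i = 0 := (Jmat_mulVec hrn d K x i).symm.trans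
      (congrFun (LinearMap.mem_ker.1 hx) i)
    refine ⟨fun j => x (finSplit hrn (Sum.inr j)), ?_, fun i =>
      ⟨-x (finSplit hrn (Sum.inl i)), ?_⟩⟩
    · ext k
      obtain ⟨i | j, rfl⟩ := (finSplit hrn).surjective k
      · rw [Vcomb_inl, div_eq_iff hd', ← map_neg, ← eq_neg_of_add_eq_zero_left (hJ i), mul_comm,
          map_mul]
        rfl
      · rw [Vcomb_inr]
        rfl
    · linear_combination hJ i
  · rintro ⟨y, rfl, hy⟩
    choose w hw using hy
    let x : Fin n → R := fun k => Sum.elim (fun i => -w i) y ((finSplit hrn).symm k)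
    have hxl (i) : x (finSplit hrn (Sum.inl i)) = -w i := by simp [x]
    have hxr (j) : x (finSplit hrn (Sum.inr j)) = y j := by simp [x]
    refine ⟨x, LinearMap.mem_ker.2 (funext fun i => ?_), funext fun k => ?_⟩
    · rw [Matrix.mulVecLin_apply, Jmat_mulVec hrn]
      simp only [hxl, hxr, hw]
      simp
    · change algebraMap R (FractionRing R) (x k) = _
      obtain ⟨i | j, rfl⟩ := (finSplit hrn).surjective k
      · rw [Vcomb_inl, hxl, hw, eq_div_iff hd']
        simp [mul_comm]
      · rw [Vcomb_inr, hxr]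

end

/-- For `S` the rectangular diagonal matrix with entries `q`, of which exactly the first `t` are
nonzero, and `d = g i * c i` with `g i` a gcd of `d` and `q i`, the vectors `z` with `S z`
divisible by `d` are those with `c i ∣ z i` for `i < t`. -/
theorem dvd_diagonal_mulVec_iff {R : Type*} [CommRing R] [IsDomain R] [IsPrincipalIdealRing R]
    {r f : ℕ} {d : R} (hd : d ≠ 0) (q : Fin (min r f) → R)
    {t : ℕ} (htle : t ≤ min r f) (ht : ∀ i : Fin (min r f), q i ≠ 0 ↔ (i : ℕ) < t)
    {g c : Fin t → R} (hc : ∀ i, d = g i * c i)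
    (hg : ∀ i : Fin t, g i ∣ d ∧ g i ∣ q (Fin.castLE htle i) ∧
        ∀ c : R, c ∣ d → c ∣ q (Fin.castLE htle i) → c ∣ g i)
    (S : Matrix (Fin r) (Fin f) R)
    (hS : S = fun (i : Fin r) (j : Fin f) =>
      if h : (i : ℕ) = (j : ℕ) then q ⟨(i : ℕ), by have := i.isLt; have := j.isLt; omega⟩
      else 0) (z : Fin f → R) :
    (∀ i, d ∣ S.mulVec z i) ↔ ∀ j : Fin f, ∀ h : (j : ℕ) < t, c ⟨j, h⟩ ∣ z j := by
  have hrow (i : Fin r) (hi : (i : ℕ) < f) :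
      S.mulVec z i = q ⟨i, by have := i.isLt; omega⟩ * z ⟨i, hi⟩ := by
    rw [Matrix.mulVec, dotProduct, Finset.sum_eq_single ⟨i, hi⟩]
    · simp [hS]
    · intro j _ hj
      have : (i : ℕ) ≠ j := fun h => hj (Fin.ext h.symm)
      simp [hS, this]
    · simp
  have key (i : Fin t) (z : R) : d ∣ q (Fin.castLE htle i) * z ↔ c i ∣ z :=
    dvd_mul_iff_of_isGCD hd (hc i) (hg i).2.1 (hg i).2.2 z
  constructor
  · intro h j hj
    have := h ⟨j, by omega⟩
    rw [hrow _ j.isLt] at this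
    exact (key ⟨j, hj⟩ _).1 this
  · intro h i
    by_cases hif : (i : ℕ) < f
    · rw [hrow i hif]
      by_cases hit : (i : ℕ) < t
      · exact (key ⟨i, hit⟩ _).2 (h ⟨i, hif⟩ hit)
      · have : q ⟨i, by have := i.isLt; omega⟩ = 0 := by
          by_contra h0
          exact hit ((ht _).1 h0)
        simp [this]
    · have : S.mulVec z i = 0 := by
        rw [Matrix.mulVec, dotProduct]
        refine Finset.sum_eq_zero fun j _ => ?_
        have : (i : ℕ) ≠ j := by omega
        simp [hS, this]
      simp [this]

/-- The projection of `R^f` onto `R/(g_1) ⊕ ⋯ ⊕ R/(g_t) ⊕ (R/(d))^{f-t}`. -/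
def prodMk {R : Type*} [CommRing R] {f t : ℕ} (htf : t ≤ f) (d : R) (g : Fin t → R) :
    (Fin f → R) →ₗ[R] ((i : Fin t) → R ⧸ Ideal.span {g i}) × (Fin (f - t) → R ⧸ Ideal.span {d}) :=
  (LinearMap.pi fun i => (Ideal.span {g i}).mkQ.comp
      (LinearMap.proj (finSplit htf (Sum.inl i)))).prod
    (LinearMap.pi fun j => (Ideal.span {d}).mkQ.comp
      (LinearMap.proj (finSplit htf (Sum.inr j))))

theorem prodMk_surjective {R : Type*} [CommRing R] {f t : ℕ} (htf : t ≤ f) (d : R)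
    (g : Fin t → R) : Function.Surjective (prodMk htf d g) := by
  rintro ⟨a, b⟩
  choose a' ha using fun i => Submodule.mkQ_surjective _ (a i)
  choose b' hb using fun i => Submodule.mkQ_surjective _ (b i)
  refine ⟨fun k => Sum.elim a' b' ((finSplit htf).symm k), Prod.ext ?_ ?_⟩
  · funext i
    simpa [prodMk] using ha i
  · funext j
    simpa [prodMk] using hb j

theorem prodMk_eq_zero_iff {R : Type*} [CommRing R] {f t : ℕ} (htf : t ≤ f) (d : R)
    (g : Fin t → R) (z : Fin f → R) :
    prodMk htf d g z = 0 ↔ (∀ i, g i ∣ z (finSplit htf (Sum.inl i))) ∧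
      ∀ j, d ∣ z (finSplit htf (Sum.inr j)) := by
  simp [prodMk, Prod.ext_iff, funext_iff, Ideal.Quotient.eq_zero_iff_dvd]

/-- Let `q_1 | ⋯ | q_s` be the diagonal of the Smith normal form
of `K` and `t` the rank of `K`. Then
`N/dW ≅ R/R·gcd(d,q_1) ⊕ ⋯ ⊕ R/R·gcd(d,q_t) ⊕ (R/Rd)^{f-t}`. -/
theorem N_quot_dW_structure
    (R : Type*) [CommRing R] [IsDomain R] [IsPrincipalIdealRing R]
    (r n : ℕ) (hr : 0 < r) (hrn : r < n) (d : R) (hd : d ≠ 0)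
    (K : Matrix (Fin r) (Fin (n - r)) R)
    (P : (Matrix (Fin r) (Fin r) R)ˣ) (Q : (Matrix (Fin (n - r)) (Fin (n - r)) R)ˣ)
    (q : Fin (min r (n - r)) → R)
    (hqchain : ∀ i j, i ≤ j → q i ∣ q j)
    (hsnf : P.val * K * Q.val = fun (i : Fin r) (j : Fin (n - r)) =>
      if h : (i : ℕ) = (j : ℕ) then q ⟨(i : ℕ), by have := i.isLt; have := j.isLt; omega⟩
      else 0)
    (t : ℕ) (htle : t ≤ min r (n - r))
    (ht : ∀ i : Fin (min r (n - r)), q i ≠ 0 ↔ (i : ℕ) < t) :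
    ∀ g : Fin t → R,
      (∀ i : Fin t, g i ∣ d ∧ g i ∣ q (Fin.castLE htle i) ∧
        ∀ c : R, c ∣ d → c ∣ q (Fin.castLE htle i) → c ∣ g i) →
      Nonempty
        ((↥(Nsub R r n d K) ⧸
            ((d • Wsub R r n d K).comap (Nsub R r n d K).subtype)) ≃ₗ[R]
          (((i : Fin t) → R ⧸ Ideal.span {g i}) ×
            (Fin (n - r - t) → R ⧸ Ideal.span {d}))) := by
  intro g hg
  have hle : r ≤ n := hrn.le
  have htf : t ≤ n - r := htle.trans (min_le_right _ _)
  choose c hc using fun i => (hg i).1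
  have hc0 (i) : c i ≠ 0 := fun h => hd (by rw [hc i, h, mul_zero])
  let c' : Fin (n - r) → R := fun k => Sum.elim c (fun _ => 1) ((finSplit htf).symm k)
  have hcl (i) : c' (finSplit htf (Sum.inl i)) = c i := by simp [c']
  have hcr (j) : c' (finSplit htf (Sum.inr j)) = 1 := by simp [c']
  have hc'0 (k) : c' k ≠ 0 := by
    obtain ⟨i | j, rfl⟩ := (finSplit htf).surjective k
    · exact hcl i ▸ hc0 i
    · exact hcr j ▸ one_ne_zero
  let Ψ := (Vcomb d K).comp (Q.val.mulVecLin.comp (Matrix.diagonal c').mulVecLin)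
  have hΨ (z) : Ψ z = Vcomb d K (Q.val.mulVec fun k => c' k * z k) := by
    simp only [Ψ, LinearMap.comp_apply, Matrix.mulVecLin_apply]
    congr 2
    ext k
    rw [Matrix.mulVec_diagonal]
  have hK (z : Fin (n - r) → R) :
      (∀ i, d ∣ K.mulVec (Q.val.mulVec z) i) ↔ ∀ k, c' k ∣ z k := by
    rw [← dvd_units_mulVec_iff P, Matrix.mulVec_mulVec, Matrix.mulVec_mulVec,
      dvd_diagonal_mulVec_iff hd q htle ht hc hg _ hsnf]
    constructor
    · intro h k
      obtain ⟨i | j, rfl⟩ := (finSplit htf).surjective k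
      · rw [hcl]
        simpa using h (finSplit htf (Sum.inl i)) (by simp)
      · simp [hcr]
    · intro h k hk
      have hk' : k = finSplit htf (Sum.inl ⟨k, hk⟩) := Fin.ext (by simp)
      have := h (finSplit htf (Sum.inl ⟨k, hk⟩))
      rwa [hcl, ← hk'] at this
  refine nonempty_quotient_comap_subtype_equiv _ _ Ψ ?_ ?_ (prodMk htf d g)
    (prodMk_surjective htf d g) ?_
  · intro y z h
    rw [hΨ, hΨ] at h
    have h := congrArg Q⁻¹.val.mulVec (Vcomb_injective d K hle h)
    simp only [Matrix.mulVec_mulVec, Q.inv_mul, Matrix.one_mulVec] at h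
    exact funext fun k => mul_left_cancel₀ (hc'0 k) (congrFun h k)
  · ext v
    rw [mem_Nsub_iff K hle hd]
    constructor
    · rintro ⟨z, rfl⟩
      exact ⟨_, (hΨ z).symm, (hK _).2 fun k => dvd_mul_right _ _⟩
    · rintro ⟨y, rfl, hy⟩
      have hQ : Q.val.mulVec (Q⁻¹.val.mulVec y) = y := by
        rw [Matrix.mulVec_mulVec, Q.mul_inv, Matrix.one_mulVec]
      rw [← hQ, hK] at hy
      choose w hw using hy
      refine ⟨w, ?_⟩
      rw [hΨ, ← hQ]
      exact congrArg _ (congrArg _ (funext fun k => (hw k).symm))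
  · intro z
    rw [hΨ, Vcomb_mem_smul_Wsub_iff d K hle, dvd_units_mulVec_iff, prodMk_eq_zero_iff,
      ← (finSplit htf).forall_congr_right, Sum.forall]
    refine and_congr (forall_congr' fun i => ?_) (forall_congr' fun j => ?_)
    · rw [hcl, mul_comm, hc i, mul_dvd_mul_iff_right (hc0 i)]
    · rw [hcr, one_mul]
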